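/- For every integer m ≥ 0, the m-th derivatives of G and F satisfy G^{(m)}(x)/F^{(m)}(x) → 2 as x → 0 from the right (where G^{(m)} and F^{(m)} denote m-fold iterated derivatives on (0,∞)). -/

import Mathlib

open Filter Real

/-- `Q j = ∏_{ℓ=1}^{j} (1 - 2^{-ℓ})`. -/
noncomputable def Q (j : ℕ) : ℝ := ∏ l ∈ Finset.range j, (1 - (2:ℝ)^(-(l:ℤ)-1))

/-- `Q_∞ = ∏_{ℓ≥1} (1 - 2^{-ℓ})`. -/
noncomputable def Qinf : ℝ := ∏' l : ℕ, (1 - (2:ℝ)^(-(l:ℤ)-1))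

/-- `F(x) = ∑_{j≥0} (-1)^j 2^{-j(j-1)/2} e^{-2^j x} / (Q_j Q_∞)`. -/
noncomputable def F (x : ℝ) : ℝ :=
  ∑' j : ℕ, (-1:ℝ)^j * ((2:ℝ)^(j.choose 2))⁻¹ * Real.exp (-(2:ℝ)^j * x) / (Q j * Qinf)

/-- `φ(u,v;x) = e^{-ux} ∫_0^x t e^{(u-v)t} dt`. -/
noncomputable def phi (u v x : ℝ) : ℝ :=
  Real.exp (-u * x) * ∫ t in (0:ℝ)..x, t * Real.exp ((u - v) * t)

/-- The function `G` describing the asymptotic variance of the external profile. -/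
noncomputable def G (x : ℝ) : ℝ :=
  ∑' j : ℕ, ∑' r : ℕ, ∑ h ∈ Finset.range (j+1), ∑ l ∈ Finset.range (j+1),
    (-1:ℝ)^(r+h+l) *
      (2:ℝ)^(-(j:ℤ) - (r.choose 2 : ℤ) - (h.choose 2 : ℤ) - (l.choose 2 : ℤ)
        + 2*(h:ℤ) + 2*(l:ℤ)) *
      phi ((2:ℝ)^(r+j)) ((2:ℝ)^h + (2:ℝ)^l) x /
      (Qinf * Q r * Q h * Q (j-h) * Q l * Q (j-l))



lemma two_pow_aux (l : ℕ) : (2:ℝ)^(-(l:ℤ)-1) = (1/2)^(l+1) := by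
  rw [show (-(l:ℤ)-1) = -((l+1:ℕ):ℤ) by push_cast; ring, zpow_neg, zpow_natCast]
  simp

lemma Q_succ (j : ℕ) : Q (j+1) = Q j * (1 - (1/2)^(j+1)) := by
  unfold Q
  rw [Finset.prod_range_succ, two_pow_aux]

lemma Q_zero : Q 0 = 1 := by simp [Q]

lemma half_pow_le (j : ℕ) : (1/2:ℝ)^(j+1) ≤ 1/2 := by
  rw [pow_succ]
  have : (1/2:ℝ)^j ≤ 1 := pow_le_one₀ (by norm_num) (by norm_num)
  linarith

lemma Q_lower (j : ℕ) : 1/4 + (1/2:ℝ)^(j+1)/2 ≤ Q (j+1) := by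
  induction j with
  | zero => rw [Q_succ, Q_zero]; norm_num
  | succ j ih =>
    rw [Q_succ]
    have h1 := half_pow_le j
    have h0 : (0:ℝ) < (1/2)^(j+1) := by positivity
    rw [pow_succ _ (j+1)]
    set y := (1/2:ℝ)^(j+1)
    nlinarith [mul_nonneg h0.le (sub_nonneg.2 h1)]

lemma Q_ge (j : ℕ) : 1/4 ≤ Q j := by
  cases j with
  | zero => rw [Q_zero]; norm_num
  | succ j =>
    have := Q_lower j
    have h0 : (0:ℝ) < (1/2)^(j+1) := by positivity
    linarith

lemma Q_pos (j : ℕ) : 0 < Q j := lt_of_lt_of_le (by norm_num) (Q_ge j)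

lemma Q_tendsto : Tendsto Q atTop (nhds Qinf) := by
  have hs : Summable (fun l : ℕ => -(2:ℝ)^(-(l:ℤ)-1)) := by
    simp_rw [two_pow_aux]
    exact ((summable_nat_add_iff 1).2 summable_geometric_two).neg
  have hm : Multipliable (fun l : ℕ => 1 + -(2:ℝ)^(-(l:ℤ)-1)) :=
    Real.multipliable_one_add_of_summable hs
  have := hm.hasProd.tendsto_prod_nat
  simp only [← sub_eq_add_neg] at this
  exact this

lemma Qinf_ge : 1/4 ≤ Qinf := ge_of_tendsto' Q_tendsto Q_ge

lemma Qinf_pos : 0 < Qinf := lt_of_lt_of_le (by norm_num) Qinf_ge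

/-- coefficients of the finite approximations -/
noncomputable def cc (j h : ℕ) : ℝ := (-1:ℝ)^h * ((2:ℝ)^(h.choose 2))⁻¹ / (Q h * Q (j-h))

/-- coefficients of `F` -/
noncomputable def aa (h : ℕ) : ℝ := (-1:ℝ)^h * ((2:ℝ)^(h.choose 2))⁻¹ / (Q h * Qinf)

lemma abs_cc_le (j h : ℕ) : |cc j h| ≤ 16 * ((2:ℝ)^(h.choose 2))⁻¹ := by
  unfold cc
  rw [abs_div, abs_mul, abs_pow, abs_neg, abs_one, one_pow, one_mul, abs_of_pos (by positivity),
    abs_of_pos (mul_pos (Q_pos _) (Q_pos _)), div_le_iff₀ (mul_pos (Q_pos _) (Q_pos _))]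
  have : 1/4 * (1/4) ≤ Q h * Q (j-h) :=
    mul_le_mul (Q_ge _) (Q_ge _) (by norm_num) (Q_pos _).le
  have h2 : (0:ℝ) < ((2:ℝ)^(h.choose 2))⁻¹ := by positivity
  nlinarith

lemma abs_aa_le (h : ℕ) : |aa h| ≤ 16 * ((2:ℝ)^(h.choose 2))⁻¹ := by
  unfold aa
  rw [abs_div, abs_mul, abs_pow, abs_neg, abs_one, one_pow, one_mul, abs_of_pos (by positivity),
    abs_of_pos (mul_pos (Q_pos _) Qinf_pos), div_le_iff₀ (mul_pos (Q_pos _) Qinf_pos)]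
  have : 1/4 * (1/4) ≤ Q h * Qinf :=
    mul_le_mul (Q_ge _) Qinf_ge (by norm_num) (Q_pos _).le
  have h2 : (0:ℝ) < ((2:ℝ)^(h.choose 2))⁻¹ := by positivity
  nlinarith

lemma summable_q (m : ℕ) : Summable (fun h : ℕ => ((2:ℝ)^(h.choose 2))⁻¹ * ((2:ℝ)^h)^m) := by
  have hb : ∀ h : ℕ, ((2:ℝ)^(h.choose 2))⁻¹ * ((2:ℝ)^h)^m ≤ 2^((m+2).choose 2) * (1/2)^h := by
    intro h
    have key : h * m + h ≤ (m+2).choose 2 + h.choose 2 := by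
      rw [Nat.choose_two_right, Nat.choose_two_right]
      have e1 : 2 ∣ (m+2)*(m+2-1) := (Nat.even_mul_pred_self _).two_dvd
      have e2 : 2 ∣ h*(h-1) := (Nat.even_mul_pred_self _).two_dvd
      obtain ⟨p, hp⟩ := e1
      obtain ⟨q, hq⟩ := e2
      rw [hp, hq]
      simp only [Nat.mul_div_cancel_left _ (by norm_num : 0 < 2)]
      cases h with
      | zero => omega
      | succ k =>
        simp only [Nat.add_sub_cancel, show m + 2 - 1 = m + 1 by omega] at hp hq
        zify at *
        have : 0 ≤ ((m:ℤ) - k) * (m - k + 1) := by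
          rcases le_or_gt (k:ℤ) m with h | h
          · apply mul_nonneg <;> linarith
          · apply mul_nonneg_of_nonpos_of_nonpos <;> linarith [Int.add_one_le_iff.2 h]
        nlinarith
    rw [← pow_mul, one_div, inv_pow, inv_mul_le_iff₀ (by positivity), ← mul_assoc,
      le_mul_inv_iff₀ (by positivity), ← pow_add, ← pow_add]
    apply pow_le_pow_right₀ (by norm_num)
    omega
  exact Summable.of_nonneg_of_le (fun h => by positivity) hb
    (summable_geometric_two.mul_left _)

lemma summable_q0 : Summable (fun h : ℕ => ((2:ℝ)^(h.choose 2))⁻¹) := by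
  simpa using summable_q 0

lemma summable_aa (m : ℕ) : Summable (fun h : ℕ => |aa h| * ((2:ℝ)^h)^m) := by
  refine Summable.of_nonneg_of_le (fun h => by positivity) (fun h => ?_) ((summable_q m).mul_left 16)
  rw [← mul_assoc]
  exact mul_le_mul_of_nonneg_right (abs_aa_le h) (by positivity)

lemma choose_two_succ (h : ℕ) : (h+1).choose 2 = h.choose 2 + h := by
  rw [Nat.choose_succ_succ' h 1]; simp; ring

lemma qfac_ne (j : ℕ) : (1 - (1/2:ℝ)^(j+1)) ≠ 0 := by
  have := half_pow_le j
  intro h; linarith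

lemma aa_rec (h : ℕ) : aa (h+1) * (1 - 2^(h+1)) = 2 * aa h := by
  unfold aa
  rw [Q_succ, choose_two_succ]
  have h1 := qfac_ne h
  have h2 := (Q_pos h).ne'
  have h3 := Qinf_pos.ne'
  have h4 : (1 - (2:ℝ)^(h+1)) = - 2^(h+1) * (1 - (1/2)^(h+1)) := by
    have : (2:ℝ)^(h+1) * (1/2)^(h+1) = 1 := by rw [← mul_pow]; norm_num
    linear_combination -this
  rw [h4]
  field_simp
  ring

lemma cc_rec1 (j h : ℕ) : cc (j+1) (h+1) * (1 - 2^(h+1)) = 2 * cc j h := by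
  unfold cc
  rw [Q_succ, choose_two_succ, Nat.add_sub_add_right]
  have h1 := qfac_ne h
  have h2 := (Q_pos h).ne'
  have h3 := (Q_pos (j-h)).ne'
  have h4 : (1 - (2:ℝ)^(h+1)) = - 2^(h+1) * (1 - (1/2)^(h+1)) := by
    have : (2:ℝ)^(h+1) * (1/2)^(h+1) = 1 := by rw [← mul_pow]; norm_num
    linear_combination -this
  rw [h4]
  field_simp
  ring

lemma cc_rec2 (j h : ℕ) (hh : h ≤ j) : cc (j+1) h * (2^(j+1) - 2^h) = 2^(j+1) * cc j h := by
  unfold cc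
  obtain ⟨d, rfl⟩ := Nat.exists_eq_add_of_le hh
  rw [show h + d + 1 - h = d + 1 by omega, show h + d - h = d by omega, Q_succ]
  have h1 := qfac_ne d
  have h2 := (Q_pos h).ne'
  have h3 := (Q_pos d).ne'
  have h4 : ((2:ℝ)^(h+d+1) - 2^h) = 2^(h+d+1) * (1 - (1/2)^(d+1)) := by
    have : (2:ℝ)^(d+1) * (1/2)^(d+1) = 1 := by rw [← mul_pow]; norm_num
    rw [show h+d+1 = h+(d+1) by ring, pow_add]
    linear_combination 2^h * this
  rw [h4]
  field_simp

/-- moments -/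
noncomputable def MM (j i : ℕ) : ℝ := ∑ h ∈ Finset.range (j+1), cc j h * ((2:ℝ)^h)^i

lemma MM_rec2 (j i : ℕ) : MM (j+1) (i+1) = 2^(j+1) * MM (j+1) i - 2^(j+1) * MM j i := by
  have : 2^(j+1) * MM (j+1) i - MM (j+1) (i+1) = 2^(j+1) * MM j i := by
    unfold MM
    rw [Finset.mul_sum, ← Finset.sum_sub_distrib, Finset.mul_sum, Finset.sum_range_succ]
    rw [show (2:ℝ)^(j+1) * (cc (j+1) (j+1) * (2^(j+1))^i) - cc (j+1) (j+1) * (2^(j+1))^(i+1) = 0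
      by ring, add_zero]
    apply Finset.sum_congr rfl
    intro h hh
    have := cc_rec2 j h (Nat.lt_succ_iff.1 (Finset.mem_range.1 hh))
    linear_combination ((2:ℝ)^h)^i * this
  linarith

lemma MM_rec1 (j : ℕ) : MM (j+1) 0 - MM (j+1) 1 = 2 * MM j 0 := by
  unfold MM
  rw [← Finset.sum_sub_distrib, Finset.mul_sum, Finset.sum_range_succ']
  simp only [pow_zero, pow_one, mul_one, sub_self, add_zero]
  apply Finset.sum_congr rfl
  intro h _
  have := cc_rec1 j h
  linear_combination this

lemma MM_zero (j : ℕ) : MM (j+1) 0 = 0 := by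
  induction j with
  | zero =>
    have h1 := MM_rec1 0
    have h2 := MM_rec2 0 0
    norm_num at h1 h2
    linarith
  | succ j ih =>
    have h1 := MM_rec1 (j+1)
    have h2 := MM_rec2 (j+1) 0
    rw [ih] at h1 h2
    have h3 : (2:ℝ)^(j+1+1) - 1 ≠ 0 := by
      have : (1:ℝ) < 2^(j+1+1) := one_lt_pow₀ (by norm_num) (by omega)
      linarith
    have : (2^(j+1+1) - 1) * MM (j+1+1) 0 = 0 := by
      simp only [zero_add] at h2
      linear_combination -h1 - h2
    exact (mul_eq_zero.1 this).resolve_left h3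

lemma MM_vanish (i : ℕ) : ∀ j, i < j → MM j i = 0 := by
  induction i with
  | zero =>
    intro j hj
    obtain ⟨k, rfl⟩ := Nat.exists_eq_add_of_lt hj
    rw [zero_add]; exact MM_zero k
  | succ i ih =>
    intro j hj
    obtain ⟨k, rfl⟩ := Nat.exists_eq_add_of_lt (show 0 < j by omega)
    rw [zero_add] at *
    rw [MM_rec2, ih _ (by omega), ih _ (by omega)]; ring

lemma MM_two_two : MM 2 2 = 8 := by
  have h1 := MM_rec2 1 1
  have h2 := MM_rec2 0 0
  rw [MM_vanish 1 2 (by norm_num)] at h1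
  rw [MM_vanish 0 1 (by norm_num)] at h2
  have : MM 0 0 = 1 := by simp [MM, cc, Q_zero]
  norm_num at h1 h2
  rw [h1, h2, this]; norm_num


noncomputable def ff (j : ℕ) (x : ℝ) : ℝ :=
  ∑ h ∈ Finset.range (j+1), cc j h * Real.exp (-(2:ℝ)^h * x)

noncomputable def Fs (x : ℝ) : ℝ := ∑' j : ℕ, aa j * Real.exp (-(2:ℝ)^j * x)

lemma F_eq_Fs (x : ℝ) : F x = Fs x := by
  unfold F Fs aa
  refine tsum_congr fun j => ?_
  ring

lemma hasDerivAt_exp_neg (c x : ℝ) :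
    HasDerivAt (fun x => Real.exp (-c * x)) (-c * Real.exp (-c * x)) x := by
  have := ((hasDerivAt_id x).const_mul (-c)).exp
  simp only [id, mul_one] at this
  rw [mul_comm (-c) (Real.exp _)]
  exact this

lemma ff_hasDerivAt (j : ℕ) (x : ℝ) :
    HasDerivAt (ff (j+1)) (2 * ff j (2*x) - ff (j+1) x) x := by
  have h1 : HasDerivAt (ff (j+1)) (∑ h ∈ Finset.range (j+1+1), cc (j+1) h *
      (-(2:ℝ)^h * Real.exp (-(2:ℝ)^h * x))) x := by
    unfold ff
    apply HasDerivAt.fun_sum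
    intro h _
    exact (hasDerivAt_exp_neg _ _).const_mul _
  convert h1 using 1
  have : 2 * ff j (2*x) = ff (j+1) x + ∑ h ∈ Finset.range (j+1+1), cc (j+1) h *
      (-(2:ℝ)^h * Real.exp (-(2:ℝ)^h * x)) := by
    unfold ff
    rw [← Finset.sum_add_distrib, Finset.mul_sum, Finset.sum_range_succ' _ (j+1)]
    rw [show ∀ y : ℝ, cc (j+1) 0 * Real.exp y + cc (j+1) 0 * (-2^0 * Real.exp y) = 0 by
      intro y; ring, add_zero]
    apply Finset.sum_congr rfl
    intro h _
    have := cc_rec1 j h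
    rw [show -(2:ℝ)^h * (2*x) = -2^(h+1) * x by ring]
    linear_combination - Real.exp (-2^(h+1) * x) * this
  linarith

lemma ff_zero_val (j : ℕ) : ff (j+1) 0 = 0 := by
  have := MM_zero j
  unfold MM at this
  simpa [ff] using this

lemma exp_mul_hasDerivAt {f : ℝ → ℝ} {f' x : ℝ} (h : HasDerivAt f (f' - f x) x) :
    HasDerivAt (fun y => Real.exp y * f y) (Real.exp x * f') x := by
  exact ((Real.hasDerivAt_exp x).fun_mul h).congr_deriv (by ring)

lemma ff_nonneg (j : ℕ) : ∀ x, 0 ≤ x → 0 ≤ ff j x := by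
  induction j with
  | zero => intro x _; simp [ff, cc, Q_zero]; positivity
  | succ j ih =>
    intro x hx
    have hd := fun y => exp_mul_hasDerivAt (ff_hasDerivAt j y)
    have hm : MonotoneOn (fun y => Real.exp y * ff (j+1) y) (Set.Ici 0) := by
      apply monotoneOn_of_deriv_nonneg (convex_Ici 0)
      · exact fun y _ => (hd y).continuousAt.continuousWithinAt
      · exact fun y _ => (hd y).differentiableAt.differentiableWithinAt
      · intro y hy
        rw [interior_Ici] at hy
        rw [(hd y).deriv]
        have := ih (2*y) (by have : 0 < y := hy; linarith)
        positivity
    have := hm (Set.mem_Ici.2 le_rfl) (Set.mem_Ici.2 hx) hx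
    simp only [ff_zero_val, mul_zero] at this
    exact nonneg_of_mul_nonneg_right this (Real.exp_pos x)

lemma exp_le_one_aux (h : ℕ) {x : ℝ} (hx : 0 ≤ x) : Real.exp (-(2:ℝ)^h * x) ≤ 1 := by
  rw [Real.exp_le_one_iff]
  have : (0:ℝ) ≤ 2^h * x := by positivity
  linarith

lemma cc_tendsto (h : ℕ) : Tendsto (fun j => cc j h) atTop (nhds (aa h)) := by
  unfold cc aa
  apply Tendsto.div tendsto_const_nhds
  · apply Tendsto.const_mul
    exact Q_tendsto.comp (tendsto_sub_atTop_nat h)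
  · exact (mul_pos (Q_pos _) Qinf_pos).ne'

lemma ff_tendsto {x : ℝ} (hx : 0 ≤ x) : Tendsto (fun j => ff j x) atTop (nhds (Fs x)) := by
  have e : ∀ j, ff j x = ∑' h : ℕ, if h < j + 1 then cc j h * Real.exp (-(2:ℝ)^h * x) else 0 := by
    intro j
    rw [tsum_eq_sum (s := Finset.range (j+1))]
    · unfold ff
      apply Finset.sum_congr rfl
      intro h hh
      rw [if_pos (Finset.mem_range.1 hh)]
    · intro h hh
      rw [if_neg (fun h' => hh (Finset.mem_range.2 h'))]
  simp_rw [e]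
  unfold Fs
  refine tendsto_tsum_of_dominated_convergence (summable_q0.mul_left 16) ?_ ?_
  · intro h
    refine Tendsto.congr' ?_ ((cc_tendsto h).mul_const _)
    filter_upwards [eventually_ge_atTop h] with j hj
    rw [if_pos (by omega)]
  · refine Eventually.of_forall fun j h => ?_
    split_ifs
    · rw [norm_mul, Real.norm_eq_abs, Real.norm_eq_abs, Real.abs_exp]
      calc _ ≤ |cc j h| * 1 := by gcongr; exact exp_le_one_aux h hx
        _ ≤ _ := by rw [mul_one]; exact abs_cc_le j h
    · simp

lemma Fs_zero : Fs 0 = 0 := by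
  refine tendsto_nhds_unique (ff_tendsto le_rfl) ?_
  refine tendsto_const_nhds.congr' ?_
  filter_upwards [eventually_ge_atTop 1] with j hj
  obtain ⟨k, rfl⟩ := Nat.exists_eq_add_of_le' hj
  exact (ff_zero_val k).symm

lemma Fs_nonneg {x : ℝ} (hx : 0 ≤ x) : 0 ≤ Fs x :=
  ge_of_tendsto' (ff_tendsto hx) (fun j => ff_nonneg j x hx)

lemma aa_term_bound (j : ℕ) {x : ℝ} (hx : 0 ≤ x) : ‖aa j * Real.exp (-(2:ℝ)^j * x)‖ ≤ |aa j| := by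
  rw [norm_mul, Real.norm_eq_abs, Real.norm_eq_abs, Real.abs_exp]
  calc _ ≤ |aa j| * 1 := by gcongr; exact exp_le_one_aux j hx
    _ = _ := mul_one _

lemma summable_abs_aa : Summable (fun j => |aa j|) := by simpa using summable_aa 0

lemma summable_Fs {x : ℝ} (hx : 0 ≤ x) : Summable (fun j => aa j * Real.exp (-(2:ℝ)^j * x)) :=
  Summable.of_norm_bounded summable_abs_aa (fun j => aa_term_bound j hx)

lemma Fs_continuousOn : ContinuousOn Fs (Set.Ici 0) := by
  unfold Fs
  apply continuousOn_tsum (u := fun j => |aa j|)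
  · intro j; fun_prop
  · exact summable_abs_aa
  · intro j x hx; exact aa_term_bound j hx

lemma Fs_hasDerivAt {x : ℝ} (hx : 0 < x) : HasDerivAt Fs (2 * Fs (2*x) - Fs x) x := by
  have hb : ∀ (j : ℕ) (y : ℝ), y ∈ Set.Ioi (0:ℝ) →
      ‖aa j * (-(2:ℝ)^j * Real.exp (-(2:ℝ)^j * y))‖ ≤ |aa j| * ((2:ℝ)^j)^1 := by
    intro j y hy
    have h1 := exp_le_one_aux j (le_of_lt (Set.mem_Ioi.1 hy))
    rw [norm_mul, norm_mul, norm_neg, Real.norm_eq_abs, Real.norm_eq_abs, Real.norm_eq_abs,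
      Real.abs_exp, pow_one, abs_of_pos (by positivity : (0:ℝ) < 2^j)]
    gcongr
    calc _ ≤ (2:ℝ)^j * 1 := by gcongr
      _ = _ := mul_one _
  have h1 : HasDerivAt Fs (∑' j : ℕ, aa j * (-(2:ℝ)^j * Real.exp (-(2:ℝ)^j * x))) x := by
    unfold Fs
    refine hasDerivAt_tsum_of_isPreconnected (t := Set.Ioi 0) (u := fun j => |aa j| * ((2:ℝ)^j)^1)
      (y₀ := x) (summable_aa 1) isOpen_Ioi isPreconnected_Ioi ?_ hb hx (summable_Fs hx.le) hx
    intro j y _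
    exact (hasDerivAt_exp_neg _ _).const_mul _
  convert h1 using 1
  have hs2 : Summable (fun j : ℕ => aa j * (-(2:ℝ)^j * Real.exp (-(2:ℝ)^j * x))) :=
    Summable.of_norm_bounded (summable_aa 1) (fun j => hb j x hx)
  have : 2 * Fs (2*x) = Fs x + ∑' j : ℕ, aa j * (-(2:ℝ)^j * Real.exp (-(2:ℝ)^j * x)) := by
    unfold Fs
    rw [← (summable_Fs hx.le).tsum_add hs2, ← tsum_mul_left,
      ((summable_Fs hx.le).add hs2).tsum_eq_zero_add]
    rw [show ∀ y : ℝ, aa 0 * Real.exp y + aa 0 * (-2^0 * Real.exp y) = 0 by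
      intro y; ring, zero_add]
    refine tsum_congr fun h => ?_
    have := aa_rec h
    rw [show -(2:ℝ)^h * (2*x) = -2^(h+1) * x by ring]
    linear_combination - Real.exp (-2^(h+1) * x) * this
  linarith

lemma Fs_pos_large : ∃ X : ℝ, 0 < X ∧ ∀ x, X < x → 0 < Fs x := by
  set A := ∑' j : ℕ, |aa (j+1)| with hA
  have hsA : Summable (fun j => |aa (j+1)|) := (summable_nat_add_iff 1).2 summable_abs_aa
  have hA0 : 0 ≤ A := tsum_nonneg (fun j => abs_nonneg _)
  have ha0 : 0 < aa 0 := by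
    unfold aa
    have := Qinf_pos
    have := Q_pos 0
    positivity
  have hlim : Tendsto (fun x : ℝ => A * Real.exp (-x)) atTop (nhds 0) := by
    simpa using (Real.tendsto_exp_neg_atTop_nhds_zero).const_mul A
  obtain ⟨X, hX⟩ := (eventually_atTop.1 (hlim.eventually (gt_mem_nhds ha0)))
  refine ⟨max X 1, by positivity, fun x hx => ?_⟩
  have hx1 : X ≤ x := (le_max_left _ _).trans hx.le
  have hx0 : 0 ≤ x := by have := (le_max_right X 1).trans hx.le; linarith
  have h1 := hX x hx1
  unfold Fs
  rw [(summable_Fs hx0).tsum_eq_zero_add]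
  have hs : Summable (fun j => aa (j+1) * Real.exp (-(2:ℝ)^(j+1) * x)) :=
    (summable_nat_add_iff 1).2 (summable_Fs hx0)
  have h2 : ‖∑' j : ℕ, aa (j+1) * Real.exp (-(2:ℝ)^(j+1) * x)‖ ≤ A * Real.exp (-(2*x)) := by
    refine tsum_of_norm_bounded (hsA.hasSum.mul_right (Real.exp (-(2*x)))) ?_
    intro j
    rw [norm_mul, Real.norm_eq_abs, Real.norm_eq_abs, Real.abs_exp]
    gcongr
    have : (1:ℝ) ≤ 2^j := one_le_pow₀ (by norm_num)
    rw [pow_succ]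
    nlinarith
  have h3 := neg_le_of_abs_le h2
  have h4 : Real.exp (-(2*x)) = Real.exp (-x) * Real.exp (-x) := by
    rw [← Real.exp_add]; ring_nf
  have h5 : -(2:ℝ)^0 * x = -x := by ring
  rw [h5]
  have := Real.exp_pos (-x)
  rw [h4] at h3
  nlinarith

lemma Fs_pos {x : ℝ} (hx : 0 < x) : 0 < Fs x := by
  obtain ⟨X, hX0, hX⟩ := Fs_pos_large
  have key : ∀ n : ℕ, ∀ x, X * (1/2)^n < x → 0 < Fs x := by
    intro n
    induction n with
    | zero => simpa using hX
    | succ n ih =>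
      intro x hx
      set y := X * (1/2)^(n+1) with hy
      have hy0 : 0 < y := by positivity
      have hm : StrictMonoOn (fun y => Real.exp y * Fs y) (Set.Ici y) := by
        apply strictMonoOn_of_deriv_pos (convex_Ici y)
        · intro z hz
          exact (exp_mul_hasDerivAt (Fs_hasDerivAt
            (lt_of_lt_of_le hy0 hz))).continuousAt.continuousWithinAt
        · intro z hz
          rw [interior_Ici] at hz
          have hz' : y < z := hz
          rw [(exp_mul_hasDerivAt (Fs_hasDerivAt (hy0.trans hz'))).deriv]
          have := ih (2*z) (by rw [hy, pow_succ] at hz'; linarith)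
          positivity
      have h1 := hm (Set.mem_Ici.2 le_rfl) (Set.mem_Ici.2 hx.le) hx
      have h2 := Fs_nonneg hy0.le
      have h3 : 0 < Real.exp x * Fs x := lt_of_le_of_lt (by positivity) h1
      exact pos_of_mul_pos_right h3 (Real.exp_pos x).le
  have hl : Tendsto (fun n : ℕ => X * (1/2:ℝ)^n) atTop (nhds 0) := by
    simpa using (tendsto_pow_atTop_nhds_zero_of_lt_one (by norm_num : (0:ℝ) ≤ 1/2)
      (by norm_num)).const_mul X
  obtain ⟨n, hn⟩ := (hl.eventually (gt_mem_nhds hx)).exists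
  exact key n x hn

/-- extension of `F` by zero -/
noncomputable def Fe (x : ℝ) : ℝ := Fs (max x 0)

lemma Fe_of_nonneg {x : ℝ} (hx : 0 ≤ x) : Fe x = Fs x := by rw [Fe, max_eq_left hx]

lemma Fe_of_nonpos {x : ℝ} (hx : x ≤ 0) : Fe x = 0 := by rw [Fe, max_eq_right hx, Fs_zero]

lemma Fe_continuous : Continuous Fe := by
  unfold Fe
  exact Fs_continuousOn.comp_continuous (by fun_prop) (fun x => Set.mem_Ici.2 (le_max_right _ _))

lemma Fe_bdd : ∃ C, ∀ x, |Fe x| ≤ C := by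
  refine ⟨∑' j, |aa j|, fun x => ?_⟩
  exact tsum_of_norm_bounded summable_abs_aa.hasSum (fun j => aa_term_bound j (le_max_right _ _))

lemma Fe_hasDerivAt (x : ℝ) : HasDerivAt Fe (2 * Fe (2*x) - Fe x) x := by
  have hne : ∀ y : ℝ, y ≠ 0 → HasDerivAt Fe (2 * Fe (2*y) - Fe y) y := by
    intro y hy
    rcases lt_or_gt_of_ne hy with h | h
    · rw [Fe_of_nonpos h.le, Fe_of_nonpos (by linarith)]
      simp only [mul_zero, sub_zero]
      refine (hasDerivAt_const y (0:ℝ)).congr_of_eventuallyEq ?_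
      filter_upwards [Iio_mem_nhds h] with z hz
      exact Fe_of_nonpos (le_of_lt hz)
    · rw [Fe_of_nonneg h.le, Fe_of_nonneg (by linarith)]
      refine (Fs_hasDerivAt h).congr_of_eventuallyEq ?_
      filter_upwards [Ioi_mem_nhds h] with z hz
      exact Fe_of_nonneg (le_of_lt hz)
  by_cases hx : x = 0
  · subst hx
    have hc := Fe_continuous
    refine hasDerivAt_of_hasDerivAt_of_ne (g := fun x => 2 * Fe (2*x) - Fe x) hne
      hc.continuousAt ?_
    exact Continuous.continuousAt (by fun_prop)
  · exact hne x hx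

/-- iterated derivatives of `Fe` -/
noncomputable def Fd : ℕ → ℝ → ℝ
  | 0 => Fe
  | (m+1) => fun x => 2^(m+1) * Fd m (2*x) - Fd m x

lemma Fd_hasDerivAt (m : ℕ) : ∀ x, HasDerivAt (Fd m) (Fd (m+1) x) x := by
  induction m with
  | zero => intro x; simpa [Fd] using Fe_hasDerivAt x
  | succ m ih =>
    intro x
    have h1 : HasDerivAt (fun x => Fd m (2*x)) (Fd (m+1) (2*x) * 2) x := by
      have := (ih (2*x)).comp x ((hasDerivAt_id x).const_mul 2)
      exact this.congr_deriv (by simp)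
    have h2 := (h1.const_mul (2^(m+1))).fun_sub (ih x)
    show HasDerivAt (fun x => 2^(m+1) * Fd m (2*x) - Fd m x) _ x
    refine h2.congr_deriv ?_
    simp only [Fd]
    ring

lemma Fd_continuous (m : ℕ) : Continuous (Fd m) :=
  continuous_iff_continuousAt.2 fun x => (Fd_hasDerivAt m x).continuousAt

lemma Fd_bdd (m : ℕ) : ∃ C, ∀ x, |Fd m x| ≤ C := by
  induction m with
  | zero => exact Fe_bdd
  | succ m ih =>
    obtain ⟨C, hC⟩ := ih
    refine ⟨2^(m+1) * C + C, fun x => ?_⟩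
    simp only [Fd]
    refine (abs_sub _ _).trans ?_
    rw [abs_mul, abs_of_pos (by positivity : (0:ℝ) < 2^(m+1))]
    gcongr <;> apply hC

lemma Fd_nonpos (m : ℕ) : ∀ x, x ≤ 0 → Fd m x = 0 := by
  induction m with
  | zero => intro x hx; exact Fe_of_nonpos hx
  | succ m ih =>
    intro x hx
    simp only [Fd]
    rw [ih _ hx, ih _ (by linarith)]; ring

lemma Fd_pos (m : ℕ) : ∃ δ > 0, ∀ x, 0 < x → x < δ → 0 < Fd m x := by
  induction m with
  | zero =>
    refine ⟨1, one_pos, fun x hx _ => ?_⟩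
    simp only [Fd]
    rw [Fe_of_nonneg hx.le]; exact Fs_pos hx
  | succ m ih =>
    obtain ⟨δ, hδ, h⟩ := ih
    refine ⟨min (δ/4) (1/2), by positivity, fun x hx hx' => ?_⟩
    have hx1 : x < δ/4 := hx'.trans_le (min_le_left _ _)
    have hx2 : x < 1/2 := hx'.trans_le (min_le_right _ _)
    have hd : ∀ y, HasDerivAt (fun y => Real.exp y * Fd m y)
        (Real.exp y * (2^(m+1) * Fd m (2*y))) y := fun y =>
      exp_mul_hasDerivAt (by simpa [Fd] using Fd_hasDerivAt m y)
    have hm : MonotoneOn (fun y => Real.exp y * Fd m y) (Set.Icc x (2*x)) := by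
      apply monotoneOn_of_deriv_nonneg (convex_Icc _ _)
      · exact fun y _ => (hd y).continuousAt.continuousWithinAt
      · exact fun y _ => (hd y).differentiableAt.differentiableWithinAt
      · intro y hy
        rw [interior_Icc] at hy
        rw [(hd y).deriv]
        have := h (2*y) (by linarith [hy.1]) (by linarith [hy.2])
        positivity
    have h1 := hm (Set.mem_Icc.2 ⟨le_rfl, by linarith⟩) (Set.mem_Icc.2 ⟨by linarith, le_rfl⟩)
      (by linarith)
    simp only at h1
    rw [two_mul x, Real.exp_add, mul_assoc, ← two_mul] at h1
    have h2 : Fd m x ≤ Real.exp x * Fd m (2*x) := le_of_mul_le_mul_left h1 (Real.exp_pos x)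
    have h3 : Real.exp x < 2 := by
      have h5 := Real.one_sub_le_exp_neg x
      rw [Real.exp_neg] at h5
      have h6 : (1/2:ℝ) < (Real.exp x)⁻¹ := by linarith
      rw [lt_inv_comm₀ (by norm_num) (Real.exp_pos x)] at h6
      norm_num at h6; exact h6
    have h4 := h (2*x) (by linarith) (by linarith)
    have h7 : (2:ℝ) ≤ 2^(m+1) := by
      calc (2:ℝ) = 2^1 := by norm_num
        _ ≤ 2^(m+1) := pow_le_pow_right₀ (by norm_num) (by omega)
    simp only [Fd]
    nlinarith

lemma Fd_mono (m : ℕ) : ∃ δ > 0, ∀ x, 0 < x → x < δ → 0 < Fd m x ∧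
    ∀ y ≤ x, |Fd m y| ≤ Fd m x := by
  obtain ⟨δ₁, hδ₁, h1⟩ := Fd_pos m
  obtain ⟨δ₂, hδ₂, h2⟩ := Fd_pos (m+1)
  refine ⟨min δ₁ δ₂, by positivity, fun x hx hx' => ?_⟩
  have hx1 : x < δ₁ := hx'.trans_le (min_le_left _ _)
  have hx2 : x < δ₂ := hx'.trans_le (min_le_right _ _)
  refine ⟨h1 x hx hx1, fun y hy => ?_⟩
  rcases le_or_gt y 0 with h0 | h0
  · rw [Fd_nonpos m y h0, abs_zero]; exact (h1 x hx hx1).le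
  · rw [abs_of_pos (h1 y h0 (by linarith))]
    have hm : MonotoneOn (Fd m) (Set.Icc y x) := by
      apply monotoneOn_of_deriv_nonneg (convex_Icc _ _)
      · exact (Fd_continuous m).continuousOn
      · exact fun y _ => (Fd_hasDerivAt m y).differentiableAt.differentiableWithinAt
      · intro z hz
        rw [interior_Icc] at hz
        rw [(Fd_hasDerivAt m z).deriv]
        exact (h2 z (by linarith [hz.1]) (by linarith [hz.2])).le
    exact hm (Set.mem_Icc.2 ⟨le_rfl, hy⟩) (Set.mem_Icc.2 ⟨hy, le_rfl⟩) hy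


noncomputable def dd (j h : ℕ) : ℝ := cc j h * ((2:ℝ)^h)^2

noncomputable def PP (k j : ℕ) : Polynomial ℝ :=
  ∏ i ∈ Finset.Ico k j, (Polynomial.X + Polynomial.C ((2:ℝ)^i))

/-- node sum -/
noncomputable def nd (h l : ℕ) : ℝ := (2:ℝ)^h + (2:ℝ)^l

noncomputable def ww (j k : ℕ) (t : ℝ) : ℝ :=
  ∑ h ∈ Finset.range (j+1), ∑ l ∈ Finset.range (j+1), dd j h * dd j l *
    (((PP k j).eval (-nd h l) * t + (Polynomial.derivative (PP k j)).eval (-nd h l)) *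
      Real.exp (-nd h l * t))

lemma PP_succ {k j : ℕ} (h : k < j) :
    PP k j = (Polynomial.X + Polynomial.C ((2:ℝ)^k)) * PP (k+1) j := by
  unfold PP
  rw [Finset.prod_eq_prod_Ico_succ_bot h]

lemma ww_hasDerivAt {j k : ℕ} (hk : k < j) (t : ℝ) :
    HasDerivAt (ww j (k+1)) (ww j k t - 2^k * ww j (k+1) t) t := by
  have h1 : HasDerivAt (ww j (k+1)) (∑ h ∈ Finset.range (j+1), ∑ l ∈ Finset.range (j+1),
      dd j h * dd j l *
      ((PP (k+1) j).eval (-nd h l) * 1 * Real.exp (-nd h l * t) +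
      ((PP (k+1) j).eval (-nd h l) * t + (Polynomial.derivative (PP (k+1) j)).eval (-nd h l)) *
      (-nd h l * Real.exp (-nd h l * t)))) t := by
    unfold ww
    apply HasDerivAt.fun_sum
    intro h _
    apply HasDerivAt.fun_sum
    intro l _
    apply HasDerivAt.const_mul
    exact (((hasDerivAt_id t).const_mul _).add_const _).fun_mul (hasDerivAt_exp_neg _ _)
  refine h1.congr_deriv ?_
  unfold ww
  rw [Finset.mul_sum, ← Finset.sum_sub_distrib]
  apply Finset.sum_congr rfl
  intro h _
  rw [Finset.mul_sum, ← Finset.sum_sub_distrib]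
  apply Finset.sum_congr rfl
  intro l _
  rw [PP_succ hk]
  simp only [Polynomial.derivative_mul, Polynomial.eval_mul, Polynomial.eval_add,
    Polynomial.eval_X, Polynomial.eval_C, Polynomial.derivative_add, Polynomial.derivative_X,
    Polynomial.derivative_C, Polynomial.eval_one, Polynomial.eval_zero]
  ring

lemma ww_continuous (j k : ℕ) : Continuous (ww j k) := by
  unfold ww; fun_prop

lemma ibp {j k : ℕ} (hk : k < j) (x : ℝ) :
    2^(k+1) * ∫ t in (0:ℝ)..x, Fe (2^(k+1) * (x-t)) * ww j (k+1) t =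
      (∫ t in (0:ℝ)..x, Fe (2^k * (x-t)) * ww j k t) + Fe (2^k * x) * ww j (k+1) 0 := by
  have hd : ∀ t ∈ Set.uIcc 0 x, HasDerivAt (fun t => Fe (2^k * (x-t)) * ww j (k+1) t)
      (Fe (2^k * (x-t)) * ww j k t - 2^(k+1) * (Fe (2^(k+1) * (x-t)) * ww j (k+1) t)) t := by
    intro t _
    have h1 : HasDerivAt (fun t => Fe (2^k * (x-t)))
        ((2 * Fe (2*(2^k * (x-t))) - Fe (2^k * (x-t))) * (2^k * (-1))) t := by
      exact HasDerivAt.comp (h₂ := Fe) (h := fun t => 2^k * (x-t)) t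
        (Fe_hasDerivAt (2^k * (x-t))) (((hasDerivAt_id t).const_sub x).const_mul (2^k))
    refine (h1.fun_mul (ww_hasDerivAt hk t)).congr_deriv ?_
    rw [show 2 * ((2:ℝ)^k * (x-t)) = 2^(k+1) * (x-t) by ring]
    ring
  have hF := Fe_continuous
  have hw1 := ww_continuous j k
  have hw2 := ww_continuous j (k+1)
  have hi := intervalIntegral.integral_eq_sub_of_hasDerivAt hd
    (Continuous.intervalIntegrable (by fun_prop) _ _)
  rw [intervalIntegral.integral_sub (Continuous.intervalIntegrable (by fun_prop) _ _)
    (Continuous.intervalIntegrable (by fun_prop) _ _), intervalIntegral.integral_const_mul] at hi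
  simp only [sub_self, mul_zero, sub_zero] at hi
  rw [Fe_of_nonpos le_rfl] at hi
  linarith

lemma dd_moment (j p : ℕ) : ∑ h ∈ Finset.range (j+1), dd j h * ((2:ℝ)^h)^p = MM j (p+2) := by
  unfold MM dd
  apply Finset.sum_congr rfl
  intro h _
  ring

lemma dd_pow_vanish (j n : ℕ) (hn : n + 4 < 2 * j) :
    ∑ h ∈ Finset.range (j+1), ∑ l ∈ Finset.range (j+1), dd j h * dd j l * (-nd h l)^n = 0 := by
  have e : ∀ h l, dd j h * dd j l * (-nd h l)^n = ∑ p ∈ Finset.range (n+1),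
      (-1)^n * (n.choose p) * ((dd j h * ((2:ℝ)^h)^p) * (dd j l * ((2:ℝ)^l)^(n-p))) := by
    intro h l
    rw [neg_pow, nd, add_pow, Finset.mul_sum, Finset.mul_sum]
    apply Finset.sum_congr rfl
    intro p _
    ring
  simp_rw [e]
  rw [Finset.sum_congr rfl (fun h _ => Finset.sum_comm), Finset.sum_comm]
  apply Finset.sum_eq_zero
  intro p hp
  have hp' : p ≤ n := Nat.lt_succ_iff.1 (Finset.mem_range.1 hp)
  simp_rw [← Finset.mul_sum]
  rw [← Finset.sum_mul, dd_moment, dd_moment]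
  by_cases h : p + 2 < j
  · rw [MM_vanish _ _ h]; ring
  · rw [MM_vanish (n-p+2) j (by omega)]; ring

lemma dd_poly_vanish (j : ℕ) (R : Polynomial ℝ) (hR : R.natDegree + 4 < 2 * j) :
    ∑ h ∈ Finset.range (j+1), ∑ l ∈ Finset.range (j+1), dd j h * dd j l * R.eval (-nd h l) = 0 := by
  simp_rw [Polynomial.eval_eq_sum_range, Finset.mul_sum]
  rw [Finset.sum_congr rfl (fun h _ => Finset.sum_comm), Finset.sum_comm]
  apply Finset.sum_eq_zero
  intro n hn
  have hn' : n ≤ R.natDegree := Nat.lt_succ_iff.1 (Finset.mem_range.1 hn)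
  have := dd_pow_vanish j n (by omega)
  calc _ = R.coeff n * ∑ h ∈ Finset.range (j+1), ∑ l ∈ Finset.range (j+1),
        dd j h * dd j l * (-nd h l)^n := by
        simp_rw [Finset.mul_sum]
        apply Finset.sum_congr rfl
        intro h _
        apply Finset.sum_congr rfl
        intro l _
        ring
    _ = 0 := by rw [this, mul_zero]

lemma PP_natDegree (k j : ℕ) : (PP k j).natDegree ≤ j - k := by
  unfold PP
  refine (Polynomial.natDegree_prod_le _ _).trans ?_
  calc _ ≤ ∑ i ∈ Finset.Ico k j, 1 := by
        apply Finset.sum_le_sum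
        intro i _
        exact (Polynomial.natDegree_X_add_C _).le
    _ = _ := by simp

lemma ww_boundary {j k : ℕ} (hk : k < j) :
    ww j (k+1) 0 = if j = 2 ∧ k = 0 then 64 else 0 := by
  have e : ww j (k+1) 0 = ∑ h ∈ Finset.range (j+1), ∑ l ∈ Finset.range (j+1), dd j h * dd j l *
      (Polynomial.derivative (PP (k+1) j)).eval (-nd h l) := by
    unfold ww
    simp
  rw [e]
  by_cases hkj : k + 1 = j
  · rw [if_neg (by omega)]
    have : PP (k+1) j = 1 := by unfold PP; rw [hkj]; simp
    simp [this]
  split_ifs with h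
  · obtain ⟨rfl, rfl⟩ := h
    have : PP (0+1) 2 = Polynomial.X + Polynomial.C 2 := by unfold PP; simp
    rw [this]
    have h2 := dd_moment 2 0
    rw [zero_add, MM_two_two] at h2
    simp only [pow_zero, mul_one] at h2
    simp only [Polynomial.derivative_add, Polynomial.derivative_X, Polynomial.derivative_C,
      add_zero, Polynomial.eval_one, mul_one]
    rw [← Finset.sum_mul_sum, h2]
    norm_num
  · apply dd_poly_vanish
    have h1 := Polynomial.natDegree_derivative_le (PP (k+1) j)
    have h2 := PP_natDegree (k+1) j
    omega

lemma conv_reduce (j : ℕ) (x : ℝ) : ∀ k, k ≤ j →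
    (∏ i ∈ Finset.range k, (2:ℝ)^(i+1)) * ∫ t in (0:ℝ)..x, Fe (2^k * (x-t)) * ww j k t =
      (∫ t in (0:ℝ)..x, Fe (x-t) * ww j 0 t) + if j = 2 ∧ 1 ≤ k then 64 * Fe x else 0 := by
  intro k
  induction k with
  | zero => intro _; simp
  | succ k ih =>
    intro hk
    have h1 := ih (by omega)
    rw [Finset.prod_range_succ, mul_assoc, ibp (by omega), mul_add, h1, ww_boundary (by omega)]
    by_cases hj : j = 2
    · subst hj
      have hk2 : k < 2 := by omega
      interval_cases k <;> simp; ring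
    · simp [hj]

noncomputable def KK (j : ℕ) (t : ℝ) : ℝ :=
  (1/2)^j * (∏ i ∈ Finset.range j, (2:ℝ)^(i+1))⁻¹ * ww j 0 t

lemma KK_continuous (j : ℕ) : Continuous (KK j) := by
  have := ww_continuous j 0
  unfold KK; fun_prop

lemma conv_KK (j : ℕ) (x : ℝ) :
    (1/2)^j * ∫ t in (0:ℝ)..x, Fe (2^j * (x-t)) * ww j j t =
      (∫ t in (0:ℝ)..x, Fe (x-t) * KK j t) + if j = 2 then 2 * Fe x else 0 := by
  have h := conv_reduce j x j le_rfl
  have hP : (0:ℝ) < ∏ i ∈ Finset.range j, (2:ℝ)^(i+1) := Finset.prod_pos (fun i _ => by positivity)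
  set P := ∏ i ∈ Finset.range j, (2:ℝ)^(i+1) with hPdef
  have e : (∫ t in (0:ℝ)..x, Fe (x-t) * KK j t) =
      (1/2)^j * P⁻¹ * ∫ t in (0:ℝ)..x, Fe (x-t) * ww j 0 t := by
    rw [← intervalIntegral.integral_const_mul]
    congr 1
    ext t
    unfold KK
    ring
  have e2 : (∫ t in (0:ℝ)..x, Fe (2^j * (x-t)) * ww j j t) =
    P⁻¹ * ((∫ t in (0:ℝ)..x, Fe (x-t) * ww j 0 t) + if j = 2 ∧ 1 ≤ j then 64 * Fe x else 0) := by
    rw [← h]; field_simp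
  rw [e, e2]
  by_cases hj : j = 2
  · subst hj
    have : P = 8 := by rw [hPdef]; simp [Finset.prod_range_succ]; norm_num
    rw [this]
    simp
    ring
  · simp [hj]; ring

lemma ww_top (j : ℕ) (t : ℝ) : ww j j t =
    ∑ h ∈ Finset.range (j+1), ∑ l ∈ Finset.range (j+1), dd j h * dd j l *
      (t * Real.exp (-nd h l * t)) := by
  unfold ww
  have : PP j j = 1 := by unfold PP; simp
  simp [this]


open MeasureTheory

lemma PP_bound (n : ℕ) {a : ℝ} (ha : 0 < a) :
    |(PP 0 n).eval (-a)| ≤ ∏ i ∈ Finset.range n, max a (2^i) ∧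
    a * |(Polynomial.derivative (PP 0 n)).eval (-a)| ≤ n * ∏ i ∈ Finset.range n, max a (2^i) := by
  induction n with
  | zero => simp [PP]
  | succ n ih =>
    obtain ⟨h1, h2⟩ := ih
    have e : PP 0 (n+1) = PP 0 n * (Polynomial.X + Polynomial.C ((2:ℝ)^n)) := by
      unfold PP
      rw [Finset.prod_Ico_succ_top (Nat.zero_le n)]
    have hm : |-a + 2^n| ≤ max a (2^n) := by
      have h0 : (0:ℝ) < 2^n := by positivity
      rw [abs_le]
      constructor
      · have := le_max_left a (2^n); linarith
      · have := le_max_right a (2^n); linarith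
    have hP : 0 ≤ ∏ i ∈ Finset.range n, max a ((2:ℝ)^i) :=
      Finset.prod_nonneg (fun i _ => ha.le.trans (le_max_left _ _))
    have hm2 : a ≤ max a (2^n) := le_max_left _ _
    rw [e, Finset.prod_range_succ]
    simp only [Polynomial.derivative_mul, Polynomial.eval_mul, Polynomial.eval_add,
      Polynomial.eval_X, Polynomial.eval_C, Polynomial.derivative_add, Polynomial.derivative_X,
      Polynomial.derivative_C, Polynomial.eval_one, Polynomial.eval_zero, add_zero, mul_one]
    set P := ∏ i ∈ Finset.range n, max a ((2:ℝ)^i)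
    set p := (PP 0 n).eval (-a)
    set q := (Polynomial.derivative (PP 0 n)).eval (-a)
    set M := max a ((2:ℝ)^n)
    constructor
    · rw [abs_mul]
      exact mul_le_mul h1 hm (abs_nonneg _) hP
    · calc a * |q * (-a + 2^n) + p| ≤ a * (|q| * |-a + 2^n| + |p|) := by
            gcongr
            exact (abs_add_le _ _).trans (by rw [abs_mul])
        _ = (a * |q|) * |-a + 2^n| + a * |p| := by ring
        _ ≤ (n * P) * M + M * P := by
            have : 0 ≤ (n:ℝ) * P := by positivity
            have : 0 ≤ M := ha.le.trans hm2
            gcongr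
        _ = _ := by push_cast; ring

lemma sum_max (μ j : ℕ) (h : μ ≤ j) :
    ∑ i ∈ Finset.range j, max μ i = μ.choose 2 + μ + j.choose 2 := by
  induction j, h using Nat.le_induction with
  | base =>
    have : ∑ i ∈ Finset.range μ, max μ i = ∑ i ∈ Finset.range μ, μ := by
      apply Finset.sum_congr rfl
      intro i hi
      exact max_eq_left (Finset.mem_range.1 hi).le
    rw [this]
    simp only [Finset.sum_const, Finset.card_range, smul_eq_mul]
    have h1 := Nat.triangle_succ μ
    have h2 := choose_two_succ μ
    have h3 : (μ+1).choose 2 + μ.choose 2 = μ^2 := by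
      clear h1 h2 this
      induction μ with
      | zero => rfl
      | succ k ih =>
        have a1 := choose_two_succ (k+1)
        have a2 := choose_two_succ k
        nlinarith
    nlinarith
  | succ j hj ih =>
    rw [Finset.sum_range_succ, ih, max_eq_right hj, choose_two_succ]
    ring

lemma theta_bound (d : ℕ) : (1 + (1/2:ℝ)^d)^d ≤ 3 := by
  have h1 : (1 + (1/2:ℝ)^d) ≤ Real.exp ((1/2)^d) := by
    have := Real.add_one_le_exp ((1/2:ℝ)^d); linarith
  have h2 : (d:ℝ) * (1/2)^d ≤ 1 := by
    have : (d:ℝ) < 2^d := by exact_mod_cast Nat.lt_two_pow_self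
    rw [one_div, inv_pow, mul_inv_le_iff₀ (by positivity)]
    linarith
  calc (1 + (1/2:ℝ)^d)^d ≤ (Real.exp ((1/2)^d))^d := by gcongr
    _ = Real.exp (d * (1/2)^d) := by rw [← Real.exp_nat_mul]
    _ ≤ Real.exp 1 := Real.exp_le_exp.2 h2
    _ ≤ 3 := Real.exp_one_lt_three.le

lemma three_l (l : ℕ) : 3 * l ≤ 6 + l.choose 2 := by
  rcases Nat.lt_or_ge l 4 with h | h
  · interval_cases l <;> decide
  · induction l, h using Nat.le_induction with
    | base => decide
    | succ l hl ih => rw [choose_two_succ]; omega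

lemma prod_two_pow (j : ℕ) : ∏ i ∈ Finset.range j, (2:ℝ)^(i+1) = 2^(j.choose 2 + j) := by
  induction j with
  | zero => simp
  | succ j ih => rw [Finset.prod_range_succ, ih, choose_two_succ, ← pow_add]

lemma prod_max_bound {j h l : ℕ} (hl : l ≤ h) (hh : h ≤ j) :
    ∏ i ∈ Finset.range j, max (nd h l) ((2:ℝ)^i) ≤
      2^(h.choose 2 + h + j.choose 2) * (2^l * 3 * 2^(j-h)) := by
  obtain ⟨d, rfl⟩ := Nat.exists_eq_add_of_le hl
  obtain ⟨e, rfl⟩ := Nat.exists_eq_add_of_le hh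
  set θ : ℝ := 1 + (1/2)^d with hθ
  have h0 : (0:ℝ) < (1/2)^d := by positivity
  have hθ1 : 1 ≤ θ := by linarith
  have hθ2 : θ ≤ 2 := by
    have : (1/2:ℝ)^d ≤ 1 := pow_le_one₀ (by norm_num) (by norm_num)
    linarith
  have hn : nd (l+d) l = 2^(l+d) * θ := by
    unfold nd
    have : (2:ℝ)^d * (1/2)^d = 1 := by rw [← mul_pow]; norm_num
    rw [hθ, pow_add]
    linear_combination - 2^l * this
  have h1 : ∏ i ∈ Finset.range (l+d+e), max (nd (l+d) l) ((2:ℝ)^i) ≤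
      ∏ i ∈ Finset.range (l+d+e), (2^(max (l+d) i) * θ) := by
    apply Finset.prod_le_prod
    · intro i _
      exact le_trans (by positivity) (le_max_right _ ((2:ℝ)^i))
    · intro i _
      apply max_le
      · rw [hn]
        gcongr
        · norm_num
        · exact le_max_left _ _
      · calc (2:ℝ)^i ≤ 2^(max (l+d) i) * 1 := by
              rw [mul_one]; exact pow_le_pow_right₀ (by norm_num) (le_max_right _ _)
          _ ≤ _ := by gcongr
  refine h1.trans ?_
  rw [Finset.prod_mul_distrib, Finset.prod_pow_eq_pow_sum, sum_max _ _ hh]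
  simp only [Finset.prod_const, Finset.card_range, Nat.add_sub_cancel_left]
  gcongr
  rw [pow_add, pow_add]
  have := theta_bound d
  gcongr

noncomputable def BB (j h l : ℕ) : ℝ :=
  (1/2)^j * (∏ i ∈ Finset.range j, (2:ℝ)^(i+1))⁻¹ * (|dd j h| * |dd j l|) *
    ((∏ i ∈ Finset.range j, max (nd h l) ((2:ℝ)^i)) / (nd h l)^2)

lemma nd_pos (h l : ℕ) : 0 < nd h l := by unfold nd; positivity

lemma nd_comm (h l : ℕ) : nd h l = nd l h := by unfold nd; ring

lemma BB_comm (j h l : ℕ) : BB j h l = BB j l h := by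
  unfold BB; rw [nd_comm h l, mul_comm |dd j h|]

lemma abs_dd_le (j h : ℕ) : |dd j h| ≤ 16 * ((2:ℝ)^(h.choose 2))⁻¹ * (2^h)^2 := by
  unfold dd
  rw [abs_mul, abs_of_pos (by positivity : (0:ℝ) < (2^h)^2)]
  exact mul_le_mul_of_nonneg_right (abs_cc_le j h) (by positivity)

lemma BB_bound_aux {j h l : ℕ} (hl : l ≤ h) (hh : h ≤ j) : BB j h l ≤ 49152 * (1/2)^j := by
  unfold BB
  have hnd : (2:ℝ)^h ≤ nd h l := by unfold nd; have : (0:ℝ) < 2^l := by positivity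
                                    linarith
  have hp : 0 ≤ ∏ i ∈ Finset.range j, max (nd h l) ((2:ℝ)^i) :=
      Finset.prod_nonneg (fun i _ => (nd_pos h l).le.trans (le_max_left _ _))
  have h3 := three_l l
  calc _ ≤ (1/2)^j * ((2:ℝ)^(j.choose 2 + j))⁻¹ *
        ((16 * ((2:ℝ)^(h.choose 2))⁻¹ * (2^h)^2) * (16 * ((2:ℝ)^(l.choose 2))⁻¹ * (2^l)^2)) *
        ((2^(h.choose 2 + h + j.choose 2) * (2^l * 3 * 2^(j-h))) / (2^h)^2) := by
        rw [prod_two_pow]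
        gcongr
        · exact abs_dd_le j h
        · exact abs_dd_le j l
        · exact prod_max_bound hl hh
    _ = 768 * (1/2)^j * ((2^l)^3 / 2^(l.choose 2)) := by
        obtain ⟨e, rfl⟩ := Nat.exists_eq_add_of_le hh
        rw [Nat.add_sub_cancel_left]
        simp only [pow_add]
        field_simp
        ring
    _ ≤ 768 * (1/2)^j * 64 := by
        gcongr
        rw [div_le_iff₀ (by positivity), ← pow_mul, show (64:ℝ) = 2^6 by norm_num, ← pow_add]
        exact pow_le_pow_right₀ (by norm_num) (by omega)
    _ = _ := by ring

lemma BB_bound {j h l : ℕ} (hh : h ≤ j) (hl : l ≤ j) : BB j h l ≤ 49152 * (1/2)^j := by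
  rcases le_total l h with h1 | h1
  · exact BB_bound_aux h1 hh
  · rw [BB_comm]; exact BB_bound_aux h1 hl

lemma term_bound {a p q t : ℝ} (ha : 0 < a) (ht : 0 < t) :
    |(p * t + q) * Real.exp (-a * t)| ≤ (2 * |p| / a + |q|) * Real.exp (-(a/2) * t) := by
  rw [abs_mul, Real.abs_exp, show -a * t = -(a/2) * t + -(a/2*t) by ring, Real.exp_add]
  have h1 : a/2*t * Real.exp (-(a/2*t)) ≤ 1 := by
    have h := Real.add_one_le_exp (a/2*t)
    rw [Real.exp_neg, ← div_eq_mul_inv, div_le_one (Real.exp_pos _)]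
    linarith
  have h2 : Real.exp (-(a/2*t)) ≤ 1 := by
    rw [Real.exp_le_one_iff]
    have : 0 < a/2*t := by positivity
    linarith
  have h3 : |p * t + q| ≤ |p| * t + |q| := by
    refine (abs_add_le _ _).trans ?_
    rw [abs_mul, abs_of_pos ht]
  have h4 : (|p| * t + |q|) * Real.exp (-(a/2*t)) ≤ 2 * |p| / a + |q| := by
    have e : (|p| * t + |q|) * Real.exp (-(a/2*t)) =
        2 * |p| / a * (a/2*t * Real.exp (-(a/2*t))) + |q| * Real.exp (-(a/2*t)) := by
      field_simp
    rw [e]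
    have : 0 ≤ 2 * |p| / a := by positivity
    nlinarith [abs_nonneg q]
  calc _ = |p * t + q| * Real.exp (-(a/2*t)) * Real.exp (-(a/2) * t) := by ring
    _ ≤ (|p| * t + |q|) * Real.exp (-(a/2*t)) * Real.exp (-(a/2) * t) := by gcongr
    _ ≤ _ := by gcongr

/-- pointwise majorant of the kernel -/
noncomputable def KB (j : ℕ) (t : ℝ) : ℝ :=
  (1/2)^j * (∏ i ∈ Finset.range j, (2:ℝ)^(i+1))⁻¹ *
    ∑ h ∈ Finset.range (j+1), ∑ l ∈ Finset.range (j+1), |dd j h| * |dd j l| *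
      ((2 * |(PP 0 j).eval (-nd h l)| / nd h l + |(Polynomial.derivative (PP 0 j)).eval (-nd h l)|) *
        Real.exp (-(nd h l/2) * t))

lemma KK_le_KB (j : ℕ) {t : ℝ} (ht : 0 < t) : |KK j t| ≤ KB j t := by
  unfold KK KB ww
  have hP : (0:ℝ) < ∏ i ∈ Finset.range j, (2:ℝ)^(i+1) := Finset.prod_pos (fun i _ => by positivity)
  rw [abs_mul, abs_of_pos (by positivity)]
  gcongr
  refine (Finset.abs_sum_le_sum_abs _ _).trans (Finset.sum_le_sum fun h _ => ?_)
  refine (Finset.abs_sum_le_sum_abs _ _).trans (Finset.sum_le_sum fun l _ => ?_)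
  rw [abs_mul, abs_mul]
  gcongr
  exact term_bound (nd_pos h l) ht

lemma exp_int (h l : ℕ) : IntegrableOn (fun t => Real.exp (-(nd h l/2) * t)) (Set.Ioi 0) :=
  integrableOn_exp_mul_Ioi (by have := nd_pos h l; linarith) 0

lemma KB_integrable (j : ℕ) : IntegrableOn (KB j) (Set.Ioi 0) := by
  unfold KB
  apply Integrable.const_mul
  apply integrable_finsetSum
  intro h _
  apply integrable_finsetSum
  intro l _
  apply Integrable.const_mul
  apply Integrable.const_mul
  exact exp_int h l

lemma KB_integral (j : ℕ) : ∫ t in Set.Ioi 0, KB j t ≤ 49152 * 4 * ((j+1)^3 * (1/2)^j) := by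
  have hP : (0:ℝ) < ∏ i ∈ Finset.range j, (2:ℝ)^(i+1) := Finset.prod_pos (fun i _ => by positivity)
  have e : ∫ t in Set.Ioi 0, KB j t = (1/2)^j * (∏ i ∈ Finset.range j, (2:ℝ)^(i+1))⁻¹ *
    ∑ h ∈ Finset.range (j+1), ∑ l ∈ Finset.range (j+1), |dd j h| * |dd j l| *
      ((2 * |(PP 0 j).eval (-nd h l)| / nd h l + |(Polynomial.derivative (PP 0 j)).eval (-nd h l)|) *
        (2 / nd h l)) := by
    unfold KB
    rw [integral_const_mul]
    congr 1
    rw [integral_finsetSum]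
    · apply Finset.sum_congr rfl
      intro h _
      rw [integral_finsetSum]
      · apply Finset.sum_congr rfl
        intro l _
        rw [integral_const_mul, integral_const_mul, integral_exp_mul_Ioi
          (by have := nd_pos h l; linarith)]
        congr 2
        have := nd_pos h l
        simp
      · intro l _
        exact ((exp_int h l).const_mul _).const_mul _
    · intro h _
      apply integrable_finsetSum
      intro l _
      exact ((exp_int h l).const_mul _).const_mul _
  rw [e, Finset.mul_sum]
  have hb : ∀ h ∈ Finset.range (j+1), ∀ l ∈ Finset.range (j+1),
      (1/2)^j * (∏ i ∈ Finset.range j, (2:ℝ)^(i+1))⁻¹ * (|dd j h| * |dd j l| *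
      ((2 * |(PP 0 j).eval (-nd h l)| / nd h l + |(Polynomial.derivative (PP 0 j)).eval (-nd h l)|) *
        (2 / nd h l))) ≤ 4 * (j+1) * (49152 * (1/2)^j) := by
    intro h hh l hl
    have hB := BB_bound (Nat.lt_succ_iff.1 (Finset.mem_range.1 hh))
      (Nat.lt_succ_iff.1 (Finset.mem_range.1 hl))
    obtain ⟨h1, h2⟩ := PP_bound j (nd_pos h l)
    have ha := nd_pos h l
    refine le_trans ?_ (mul_le_mul_of_nonneg_left hB (by positivity : (0:ℝ) ≤ 4 * (j+1)))
    unfold BB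
    set a := nd h l
    set PI0 := ∏ i ∈ Finset.range j, max a ((2:ℝ)^i)
    set p := |(PP 0 j).eval (-a)|
    set q := |(Polynomial.derivative (PP 0 j)).eval (-a)|
    have hPI0 : 0 ≤ PI0 := (abs_nonneg _).trans h1
    have h5 : (2 * p / a + q) * (2 / a) ≤ 4 * (j+1) * (PI0 / a^2) := by
      have : (2 * p / a + q) * (2 / a) = (4 * p + 2 * (a * q)) / a^2 := by field_simp; ring
      rw [this, ← mul_div_assoc]
      gcongr
      have : 0 ≤ (j:ℝ) * PI0 := by positivity
      nlinarith
    calc _ ≤ (1/2)^j * (∏ i ∈ Finset.range j, (2:ℝ)^(i+1))⁻¹ * (|dd j h| * |dd j l| *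
          (4 * (j+1) * (PI0 / a^2))) := by gcongr
      _ = _ := by ring
  calc _ ≤ ∑ h ∈ Finset.range (j+1), ∑ l ∈ Finset.range (j+1), 4 * ((j:ℝ)+1) * (49152 * (1/2)^j) := by
        apply Finset.sum_le_sum
        intro h hh
        rw [Finset.mul_sum]
        exact Finset.sum_le_sum (fun l hl => hb h hh l hl)
    _ = _ := by simp; ring

lemma KK_integrable (j : ℕ) : IntegrableOn (KK j) (Set.Ioi 0) := by
  refine (KB_integrable j).mono' (KK_continuous j).aestronglyMeasurable ?_
  filter_upwards [ae_restrict_mem measurableSet_Ioi] with t ht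
  exact KK_le_KB j ht

lemma KK_integral (j : ℕ) : ∫ t in Set.Ioi 0, ‖KK j t‖ ≤ 49152 * 4 * ((j+1)^3 * (1/2)^j) := by
  refine le_trans ?_ (KB_integral j)
  apply setIntegral_mono_on (KK_integrable j).norm (KB_integrable j) measurableSet_Ioi
  intro t ht
  exact KK_le_KB j ht

lemma KK_summable : Summable (fun j => ∫ t in Set.Ioi 0, ‖KK j t‖) := by
  refine Summable.of_nonneg_of_le (fun j => integral_nonneg fun t => norm_nonneg _) KK_integral ?_
  apply Summable.mul_left
  have h := summable_pow_mul_geometric_of_norm_lt_one (R := ℝ) 3 (r := 1/2) (by norm_num)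
  have h2 := ((summable_nat_add_iff 1).2 h).mul_left 2
  refine h2.congr fun j => ?_
  push_cast
  ring

noncomputable def Ktot (t : ℝ) : ℝ := ∑' j, KK j t

lemma Ktot_integrable : IntegrableOn Ktot (Set.Ioi 0) := by
  refine ⟨(Measurable.tsum fun j => (KK_continuous j).measurable).aestronglyMeasurable, ?_⟩
  have h1 : ∀ j, ∫⁻ t in Set.Ioi 0, ‖KK j t‖ₑ = ENNReal.ofReal (∫ t in Set.Ioi 0, ‖KK j t‖) := by
    intro j
    rw [ofReal_integral_norm_eq_lintegral_enorm (KK_integrable j)]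
  unfold HasFiniteIntegral
  calc ∫⁻ t in Set.Ioi 0, ‖Ktot t‖ₑ ≤ ∫⁻ t in Set.Ioi 0, ∑' j, ‖KK j t‖ₑ := by
        apply lintegral_mono
        intro t
        exact enorm_tsum_le_tsum_enorm
    _ = ∑' j, ∫⁻ t in Set.Ioi 0, ‖KK j t‖ₑ := by
        rw [lintegral_tsum]
        intro j
        exact (KK_continuous j).measurable.enorm.aemeasurable
    _ < ⊤ := by
        simp_rw [h1]
        rw [← ENNReal.ofReal_tsum_of_nonneg (fun j => integral_nonneg fun t => norm_nonneg _)
          KK_summable]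
        exact ENNReal.ofReal_lt_top

open MeasureTheory

lemma phi_eq (u v x : ℝ) :
    phi u v x = ∫ t in (0:ℝ)..x, Real.exp (-u * (x - t)) * (t * Real.exp (-v * t)) := by
  unfold phi
  rw [← intervalIntegral.integral_const_mul]
  congr 1
  ext t
  have : Real.exp (-u * x) * Real.exp ((u - v) * t) =
      Real.exp (-u * (x-t)) * Real.exp (-v * t) := by
    rw [← Real.exp_add, ← Real.exp_add]; congr 1; ring
  linear_combination t * this

lemma hasSum_phi (j h l : ℕ) {x : ℝ} (hx : 0 < x) :
    HasSum (fun r => aa r * phi ((2:ℝ)^(r+j)) (nd h l) x)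
      (∫ t in (0:ℝ)..x, Fe (2^j * (x - t)) * (t * Real.exp (-nd h l * t))) := by
  have e : (fun r => aa r * phi ((2:ℝ)^(r+j)) (nd h l) x) = fun r =>
      ∫ t in (0:ℝ)..x, aa r * Real.exp (-(2:ℝ)^r * (2^j * (x - t))) *
        (t * Real.exp (-nd h l * t)) := by
    ext r
    rw [phi_eq, ← intervalIntegral.integral_const_mul]
    congr 1
    ext t
    rw [show -(2:ℝ)^r * (2^j * (x - t)) = -(2:ℝ)^(r+j) * (x-t) by rw [pow_add]; ring]
    ring
  rw [e]
  apply intervalIntegral.hasSum_integral_of_dominated_convergence (fun n _ => |aa n| * x)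
  · intro n
    apply Continuous.aestronglyMeasurable
    fun_prop
  · intro n
    refine ae_of_all _ fun t ht => ?_
    rw [Set.uIoc_of_le hx.le] at ht
    have h0 : 0 ≤ x - t := by linarith [ht.2]
    have h1 := exp_le_one_aux n (x := 2^j * (x-t)) (by positivity)
    have h2 : Real.exp (-nd h l * t) ≤ 1 := by
      rw [Real.exp_le_one_iff]
      have := mul_pos (nd_pos h l) ht.1
      linarith
    rw [Real.norm_eq_abs, abs_mul, abs_mul, abs_mul, Real.abs_exp, Real.abs_exp,
      abs_of_pos ht.1]
    calc _ ≤ |aa n| * 1 * (x * 1) := by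
          gcongr
          · exact mul_nonneg ht.1.le (Real.exp_pos _).le
          · exact ht.2
      _ = _ := by ring
  · exact ae_of_all _ fun t _ => summable_abs_aa.mul_right x
  · exact intervalIntegrable_const
  · refine ae_of_all _ fun t ht => ?_
    rw [Set.uIoc_of_le hx.le] at ht
    have h0 : 0 ≤ x - t := by linarith [ht.2]
    have h1 : (0:ℝ) ≤ 2^j * (x-t) := by positivity
    rw [Fe_of_nonneg h1]
    exact (summable_Fs h1).hasSum.mul_right _

lemma G_term (j r h l : ℕ) (x : ℝ) :
    (-1:ℝ)^(r+h+l) *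
      (2:ℝ)^(-(j:ℤ) - (r.choose 2 : ℤ) - (h.choose 2 : ℤ) - (l.choose 2 : ℤ)
        + 2*(h:ℤ) + 2*(l:ℤ)) *
      phi ((2:ℝ)^(r+j)) ((2:ℝ)^h + (2:ℝ)^l) x /
      (Qinf * Q r * Q h * Q (j-h) * Q l * Q (j-l)) =
    (1/2)^j * (dd j h * dd j l * (aa r * phi ((2:ℝ)^(r+j)) (nd h l) x)) := by
  have e : (2:ℝ)^(-(j:ℤ) - (r.choose 2 : ℤ) - (h.choose 2 : ℤ) - (l.choose 2 : ℤ)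
        + 2*(h:ℤ) + 2*(l:ℤ)) = ((2:ℝ)^j)⁻¹ * ((2:ℝ)^(r.choose 2))⁻¹ * ((2:ℝ)^(h.choose 2))⁻¹ *
          ((2:ℝ)^(l.choose 2))⁻¹ * ((2:ℝ)^h)^2 * ((2:ℝ)^l)^2 := by
    have h2 : (2:ℝ) ≠ 0 := two_ne_zero
    rw [zpow_add₀ h2, zpow_add₀ h2, zpow_sub₀ h2, zpow_sub₀ h2, zpow_sub₀ h2, zpow_neg,
      mul_comm (2:ℤ) h, mul_comm (2:ℤ) l, zpow_mul, zpow_mul]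
    simp only [zpow_natCast]
    norm_cast
  rw [e]
  unfold dd cc aa nd
  rw [one_div, inv_pow, pow_add, pow_add]
  simp only [div_eq_mul_inv, mul_inv]
  ring

lemma G_inner (j : ℕ) {x : ℝ} (hx : 0 < x) :
    (∑' r : ℕ, ∑ h ∈ Finset.range (j+1), ∑ l ∈ Finset.range (j+1),
    (-1:ℝ)^(r+h+l) *
      (2:ℝ)^(-(j:ℤ) - (r.choose 2 : ℤ) - (h.choose 2 : ℤ) - (l.choose 2 : ℤ)
        + 2*(h:ℤ) + 2*(l:ℤ)) *
      phi ((2:ℝ)^(r+j)) ((2:ℝ)^h + (2:ℝ)^l) x /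
      (Qinf * Q r * Q h * Q (j-h) * Q l * Q (j-l))) =
    (∫ t in (0:ℝ)..x, Fe (x-t) * KK j t) + if j = 2 then 2 * Fe x else 0 := by
  rw [← conv_KK]
  simp_rw [G_term]
  have hs : HasSum (fun r => ∑ h ∈ Finset.range (j+1), ∑ l ∈ Finset.range (j+1),
      (1/2)^j * (dd j h * dd j l * (aa r * phi ((2:ℝ)^(r+j)) (nd h l) x)))
      (∑ h ∈ Finset.range (j+1), ∑ l ∈ Finset.range (j+1), (1/2)^j * (dd j h * dd j l *
        ∫ t in (0:ℝ)..x, Fe (2^j * (x - t)) * (t * Real.exp (-nd h l * t)))) :=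
    hasSum_sum fun h _ => hasSum_sum fun l _ =>
      ((hasSum_phi j h l hx).mul_left _).mul_left _
  rw [hs.tsum_eq]
  have hc := Fe_continuous
  have e : ∀ t, Fe (2^j * (x-t)) * ww j j t = ∑ h ∈ Finset.range (j+1), ∑ l ∈ Finset.range (j+1),
      dd j h * dd j l * (Fe (2^j * (x - t)) * (t * Real.exp (-nd h l * t))) := by
    intro t
    rw [ww_top, Finset.mul_sum]
    refine Finset.sum_congr rfl fun h _ => ?_
    rw [Finset.mul_sum]
    refine Finset.sum_congr rfl fun l _ => ?_
    ring
  simp_rw [e]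
  rw [intervalIntegral.integral_finsetSum, Finset.mul_sum]
  · refine Finset.sum_congr rfl fun h _ => ?_
    rw [intervalIntegral.integral_finsetSum, Finset.mul_sum]
    · refine Finset.sum_congr rfl fun l _ => ?_
      rw [intervalIntegral.integral_const_mul]
    · intro l _
      apply Continuous.intervalIntegrable
      fun_prop
  · intro h _
    apply Continuous.intervalIntegrable
    fun_prop

lemma int_Ioi {g : ℝ → ℝ} (k : ℝ → ℝ) (hg : ∀ y ≤ 0, g y = 0) {x : ℝ} (hx : 0 < x) :
    ∫ t in Set.Ioi 0, g (x-t) * k t = ∫ t in (0:ℝ)..x, g (x-t) * k t := by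
  rw [intervalIntegral.integral_of_le hx.le]
  apply setIntegral_eq_of_subset_of_forall_sdiff_eq_zero measurableSet_Ioi
  · exact fun t ht => ht.1
  · rintro t ⟨h1, h2⟩
    have : x < t := by
      by_contra hc
      exact h2 ⟨h1, not_lt.1 hc⟩
    rw [hg _ (by linarith), zero_mul]

lemma conv_integrable {g k : ℝ → ℝ} (hg : Continuous g) (hb : ∃ C, ∀ x, |g x| ≤ C)
    (hk : IntegrableOn k (Set.Ioi 0)) (x : ℝ) :
    IntegrableOn (fun t => g (x-t) * k t) (Set.Ioi 0) := by
  obtain ⟨C, hC⟩ := hb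
  apply Integrable.bdd_mul (c := C) hk
  · apply Continuous.aestronglyMeasurable
    fun_prop
  · exact ae_of_all _ fun t => hC _

lemma G_rep {x : ℝ} (hx : 0 < x) :
    G x = 2 * Fd 0 x + ∫ t in Set.Ioi 0, Fd 0 (x-t) * Ktot t := by
  change G x = 2 * Fe x + ∫ t in Set.Ioi 0, Fe (x-t) * Ktot t
  unfold G
  simp_rw [G_inner _ hx]
  obtain ⟨C, hC⟩ := Fe_bdd
  have h1 := hasSum_integral_of_summable_integral_norm (μ := volume.restrict (Set.Ioi 0))
    (F := fun j t => Fe (x-t) * KK j t)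
    (fun j => conv_integrable Fe_continuous ⟨C, hC⟩ (KK_integrable j) x) (by
      refine Summable.of_nonneg_of_le (fun j => integral_nonneg fun t => norm_nonneg _) (fun j => ?_)
        (KK_summable.mul_left C)
      rw [← integral_const_mul]
      apply integral_mono (conv_integrable Fe_continuous ⟨C, hC⟩ (KK_integrable j) x).norm
        ((KK_integrable j).norm.const_mul C)
      intro t
      simp only [norm_mul]
      gcongr
      exact hC _)
  have h2 : HasSum (fun j : ℕ => if j = 2 then 2 * Fe x else 0) (2 * Fe x) := hasSum_ite_eq 2 _
  have h3 := h1.add h2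
  have e : ∀ j, ∫ t in Set.Ioi 0, Fe (x-t) * KK j t = ∫ t in (0:ℝ)..x, Fe (x-t) * KK j t :=
    fun j => int_Ioi (KK j) (fun y hy => Fe_of_nonpos hy) hx
  simp_rw [e] at h3
  rw [h3.tsum_eq, add_comm]
  congr 2
  ext t
  rw [tsum_mul_left]
  rfl

noncomputable def HH (m : ℕ) (x : ℝ) : ℝ :=
  2 * Fd m x + ∫ t in Set.Ioi 0, Fd m (x-t) * Ktot t

lemma HH_hasDerivAt (m : ℕ) (x : ℝ) : HasDerivAt (HH m) (HH (m+1) x) x := by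
  unfold HH
  apply ((Fd_hasDerivAt m x).const_mul 2).add
  obtain ⟨C, hC⟩ := Fd_bdd (m+1)
  refine (hasDerivAt_integral_of_dominated_loc_of_deriv_le (μ := volume.restrict (Set.Ioi 0))
    (F := fun x t => Fd m (x-t) * Ktot t) (F' := fun x t => Fd (m+1) (x-t) * Ktot t)
    (bound := fun t => C * |Ktot t|) (s := Set.univ) Filter.univ_mem ?_ ?_ ?_ ?_ ?_ ?_).2
  · exact Eventually.of_forall fun y =>
      (conv_integrable (Fd_continuous m) (Fd_bdd m) Ktot_integrable y).aestronglyMeasurable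
  · exact conv_integrable (Fd_continuous m) (Fd_bdd m) Ktot_integrable x
  · exact (conv_integrable (Fd_continuous (m+1)) (Fd_bdd (m+1))
      Ktot_integrable x).aestronglyMeasurable
  · refine ae_of_all _ fun t y _ => ?_
    rw [Real.norm_eq_abs, abs_mul]
    gcongr
    exact hC _
  · exact Ktot_integrable.abs.const_mul C
  · refine ae_of_all _ fun t y _ => ?_
    exact ((Fd_hasDerivAt m (y-t)).comp_sub_const y t).mul_const _

lemma iter_eq {g : ℝ → ℝ} (H : ℕ → ℝ → ℝ) (h0 : ∀ x, 0 < x → g x = H 0 x)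
    (hd : ∀ m x, HasDerivAt (H m) (H (m+1) x) x) (m : ℕ) :
    ∀ x, 0 < x → iteratedDerivWithin m g (Set.Ioi 0) x = H m x := by
  induction m with
  | zero => intro x hx; rw [iteratedDerivWithin_zero]; exact h0 x hx
  | succ m ih =>
    intro x hx
    rw [iteratedDerivWithin_succ, derivWithin_congr (s := Set.Ioi 0) (fun y hy => ih y hy) (ih x hx)]
    exact (hd m x).hasDerivWithinAt.derivWithin (isOpen_Ioi.uniqueDiffWithinAt hx)

lemma Ktot_small : Tendsto (fun x => ∫ t in (0:ℝ)..x, |Ktot t|)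
    (nhdsWithin 0 (Set.Ioi 0)) (nhds 0) := by
  have hi : IntegrableOn (fun t => |Ktot t|) (Set.Icc 0 1) := by
    rw [integrableOn_Icc_iff_integrableOn_Ioc]
    exact IntegrableOn.mono_set (t := Set.Ioi 0) Ktot_integrable.abs Set.Ioc_subset_Ioi_self
  have h := intervalIntegral.continuousOn_primitive_interval (a := (0:ℝ)) (b := 1)
    (μ := volume) (f := fun t => |Ktot t|) (by rwa [Set.uIcc_of_le zero_le_one])
  have h2 := h 0 (by simp)
  unfold ContinuousWithinAt at h2
  beta_reduce at h2
  rw [intervalIntegral.integral_same, Set.uIcc_of_le zero_le_one] at h2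
  refine h2.mono_left ?_
  rw [← nhdsWithin_Ioc_eq_nhdsGT (zero_lt_one (α := ℝ))]
  exact nhdsWithin_mono _ Set.Ioc_subset_Icc_self

/-- For every `m ≥ 0`, `G^{(m)}(x)/F^{(m)}(x) → 2` as `x → 0⁺`, where the iterated
derivatives are taken within `(0,∞)`. -/
theorem G_deriv_ratio_tendsto_two :
    ∀ m : ℕ,
      Tendsto (fun x => iteratedDerivWithin m G (Set.Ioi 0) x /
          iteratedDerivWithin m F (Set.Ioi 0) x)
        (nhdsWithin 0 (Set.Ioi 0)) (nhds 2) := by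
  intro m
  obtain ⟨δ, hδ, hm⟩ := Fd_mono m
  rw [tendsto_iff_dist_tendsto_zero]
  refine squeeze_zero' (Eventually.of_forall fun x => dist_nonneg) ?_ Ktot_small
  filter_upwards [Ioo_mem_nhdsGT hδ] with x hx
  obtain ⟨hpos, hle⟩ := hm x hx.1 hx.2
  rw [iter_eq HH (fun x hx => G_rep hx) HH_hasDerivAt m x hx.1,
    iter_eq Fd (fun x hx => by rw [F_eq_Fs]; exact (Fe_of_nonneg hx.le).symm) Fd_hasDerivAt m x hx.1,
    Real.dist_eq]
  unfold HH
  rw [int_Ioi Ktot (Fd_nonpos m) hx.1]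
  have e : (2 * Fd m x + ∫ t in (0:ℝ)..x, Fd m (x-t) * Ktot t) / Fd m x - 2 =
      (∫ t in (0:ℝ)..x, Fd m (x-t) * Ktot t) / Fd m x := by
    field_simp
    ring
  rw [e, abs_div, abs_of_pos hpos, div_le_iff₀ hpos, ← intervalIntegral.integral_mul_const,
    ← Real.norm_eq_abs]
  apply intervalIntegral.norm_integral_le_of_norm_le hx.1.le
  · refine ae_of_all _ fun t ht => ?_
    rw [Real.norm_eq_abs, abs_mul, mul_comm]
    gcongr
    exact hle _ (by linarith [ht.1])
  · apply IntervalIntegrable.mul_const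
    rw [intervalIntegrable_iff_integrableOn_Ioc_of_le hx.1.le]
    exact IntegrableOn.mono_set (t := Set.Ioi 0) Ktot_integrable.abs Set.Ioc_subset_Ioi_self
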